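/- arXiv:2212.13045 — 2 statements merged into one kernel-verified Lean document; each statement's English description precedes it below -/
import Mathlib

section
/- Let T be a continuous t-norm on [0,1]. Then the following are equivalent: (i) T is power stable, i.e., (T(u,v))_T^(t) = T(u_T^(t), v_T^(t)) for all u, v ∈ [0,1] and all real t > 0; (ii) every u ∈ [0,1] is a power stable point, i.e., (u_T^(t₁))_T^(t₂) = u_T^(t₁·t₂) for all t₁, t₂ > 0; (iii) either T is the minimum t-norm T_M(u,v) = min(u,v), or T is strict, or T is an ordinal sum of strict t-norms, i.e., there exist a (finite or countably infinite) index set A, a family of strict t-norms (T_λ)_{λ∈A}, and a family of pairwise disjoint nonempty open subintervals ((a_λ, e_λ))_{λ∈A} of [0,1] such that T(u,v) = a_λ + (e_λ − a_λ)·T_λ((u − a_λ)/(e_λ − a_λ), (v − a_λ)/(e_λ − a_λ)) when (u,v) ∈ [a_λ, e_λ]², and T(u,v) = min(u,v) otherwise. -/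
open Set

/-- A t-norm on `[0,1]`: commutative, associative, nondecreasing in each argument,
with neutral element `1`. -/
structure IsTnorm (T : ℝ → ℝ → ℝ) : Prop where
  maps_to : ∀ x ∈ Icc (0:ℝ) 1, ∀ y ∈ Icc (0:ℝ) 1, T x y ∈ Icc (0:ℝ) 1
  comm : ∀ x ∈ Icc (0:ℝ) 1, ∀ y ∈ Icc (0:ℝ) 1, T x y = T y x
  assoc : ∀ x ∈ Icc (0:ℝ) 1, ∀ y ∈ Icc (0:ℝ) 1, ∀ z ∈ Icc (0:ℝ) 1,
    T (T x y) z = T x (T y z)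
  mono : ∀ x ∈ Icc (0:ℝ) 1, ∀ y ∈ Icc (0:ℝ) 1, ∀ z ∈ Icc (0:ℝ) 1,
    y ≤ z → T x y ≤ T x z
  one : ∀ x ∈ Icc (0:ℝ) 1, T x 1 = x

/-- A t-conorm on `[0,1]`: commutative, associative, nondecreasing in each argument,
with neutral element `0`. -/
structure IsTconorm (S : ℝ → ℝ → ℝ) : Prop where
  maps_to : ∀ x ∈ Icc (0:ℝ) 1, ∀ y ∈ Icc (0:ℝ) 1, S x y ∈ Icc (0:ℝ) 1
  comm : ∀ x ∈ Icc (0:ℝ) 1, ∀ y ∈ Icc (0:ℝ) 1, S x y = S y x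
  assoc : ∀ x ∈ Icc (0:ℝ) 1, ∀ y ∈ Icc (0:ℝ) 1, ∀ z ∈ Icc (0:ℝ) 1,
    S (S x y) z = S x (S y z)
  mono : ∀ x ∈ Icc (0:ℝ) 1, ∀ y ∈ Icc (0:ℝ) 1, ∀ z ∈ Icc (0:ℝ) 1,
    y ≤ z → S x y ≤ S x z
  zero : ∀ x ∈ Icc (0:ℝ) 1, S x 0 = x

/-- Continuity of a binary operation on the unit square. -/
def ContinuousOn2 (T : ℝ → ℝ → ℝ) : Prop :=
  ContinuousOn (fun p : ℝ × ℝ => T p.1 p.2) (Icc (0:ℝ) 1 ×ˢ Icc (0:ℝ) 1)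

/-- `n`-fold power `u_T^(n)` with respect to a t-norm: `u_T^(0) = 1`,
`u_T^(n+1) = T (u_T^(n)) u`. -/
def Tpow (T : ℝ → ℝ → ℝ) (u : ℝ) : ℕ → ℝ
  | 0 => 1
  | n + 1 => T (Tpow T u n) u

/-- `n`-fold power `u_S^(n)` with respect to a t-conorm: `u_S^(0) = 0`,
`u_S^(n+1) = S (u_S^(n)) u`. -/
def Spow (S : ℝ → ℝ → ℝ) (u : ℝ) : ℕ → ℝ
  | 0 => 0
  | n + 1 => S (Spow S u n) u

/-- `p`-th root `u_T^(1/p) = sup {v ∈ [0,1] | v_T^(p) < u}`. -/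
noncomputable def Troot (T : ℝ → ℝ → ℝ) (u : ℝ) (p : ℕ) : ℝ :=
  sSup {v ∈ Icc (0:ℝ) 1 | Tpow T v p < u}

/-- `p`-th root `u_S^(1/p) = inf {v ∈ [0,1] | v_S^(p) > u}`. -/
noncomputable def Sroot (S : ℝ → ℝ → ℝ) (u : ℝ) (p : ℕ) : ℝ :=
  sInf {v ∈ Icc (0:ℝ) 1 | u < Spow S v p}

/-- Rational power `u_T^(q/p) = (u_T^(1/p))_T^(q)`, with `r = q/p` in lowest terms. -/
noncomputable def TratPow (T : ℝ → ℝ → ℝ) (u : ℝ) (r : ℚ) : ℝ :=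
  Tpow T (Troot T u r.den) r.num.toNat

/-- Rational power `u_S^(q/p) = (u_S^(1/p))_S^(q)`, with `r = q/p` in lowest terms. -/
noncomputable def SratPow (S : ℝ → ℝ → ℝ) (u : ℝ) (r : ℚ) : ℝ :=
  Spow S (Sroot S u r.den) r.num.toNat

/-- Real power `u_T^(t) = inf {u_T^(r) | r ∈ [0,t] ∩ ℚ}`. -/
noncomputable def TrePow (T : ℝ → ℝ → ℝ) (u : ℝ) (t : ℝ) : ℝ :=
  sInf (TratPow T u '' {r : ℚ | 0 ≤ r ∧ (r : ℝ) ≤ t})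

/-- Real power `u_S^(t) = sup {u_S^(r) | r ∈ [0,t] ∩ ℚ}`. -/
noncomputable def SrePow (S : ℝ → ℝ → ℝ) (u : ℝ) (t : ℝ) : ℝ :=
  sSup (SratPow S u '' {r : ℚ | 0 ≤ r ∧ (r : ℝ) ≤ t})

/-- A t-norm is Archimedean if for all `x, y ∈ (0,1)` there is `n` with `x_T^(n) < y`. -/
def TnormArchimedean (T : ℝ → ℝ → ℝ) : Prop :=
  ∀ x ∈ Ioo (0:ℝ) 1, ∀ y ∈ Ioo (0:ℝ) 1, ∃ n : ℕ, Tpow T x n < y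

/-- Strict monotonicity of a t-norm: `T x y < T x z` whenever `x > 0` and `y < z`. -/
def TnormStrictMono (T : ℝ → ℝ → ℝ) : Prop :=
  ∀ x ∈ Icc (0:ℝ) 1, 0 < x → ∀ y ∈ Icc (0:ℝ) 1, ∀ z ∈ Icc (0:ℝ) 1, y < z → T x y < T x z

/-- Pseudo-inverse of a decreasing `G : [0,1] → [0,∞]`:
`G^(−1)(y) = sup {x ∈ [0,1] | G x > y}`. -/
noncomputable def pseudoInv (G : ℝ → ENNReal) (y : ENNReal) : ℝ :=
  sSup {x ∈ Icc (0:ℝ) 1 | y < G x}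

/-- `G : [0,1] → [0,∞]` is an additive generator of the t-norm `T`. -/
structure IsAddGen (T : ℝ → ℝ → ℝ) (G : ℝ → ENNReal) : Prop where
  strictAnti : StrictAntiOn G (Icc (0:ℝ) 1)
  rightContinuousAtZero : ContinuousWithinAt G (Icc (0:ℝ) 1) 0
  map_one : G 1 = 0
  sum_mem : ∀ x ∈ Icc (0:ℝ) 1, ∀ y ∈ Icc (0:ℝ) 1,
    G x + G y ∈ G '' Icc (0:ℝ) 1 ∪ Icc (G 0) ⊤
  eq_pseudoInv : ∀ x ∈ Icc (0:ℝ) 1, ∀ y ∈ Icc (0:ℝ) 1, T x y = pseudoInv G (G x + G y)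

/-- A strict t-norm: a continuous t-norm that is strictly monotone. -/
def IsStrictTnorm (T : ℝ → ℝ → ℝ) : Prop :=
  IsTnorm T ∧ ContinuousOn2 T ∧ TnormStrictMono T

/-- `T` is an ordinal sum of strict t-norms. -/
def IsOrdinalSumOfStrict (T : ℝ → ℝ → ℝ) : Prop :=
  ∃ (A : Type) (_ : Countable A) (a e : A → ℝ) (Tf : A → ℝ → ℝ → ℝ),
    (∀ i : A, 0 ≤ a i ∧ a i < e i ∧ e i ≤ 1) ∧
    (Pairwise fun i j : A => Disjoint (Ioo (a i) (e i)) (Ioo (a j) (e j))) ∧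
    (∀ i : A, IsStrictTnorm (Tf i)) ∧
    (∀ u ∈ Icc (0:ℝ) 1, ∀ v ∈ Icc (0:ℝ) 1,
      (∀ i : A, u ∈ Icc (a i) (e i) → v ∈ Icc (a i) (e i) →
        T u v = a i + (e i - a i) *
          Tf i ((u - a i) / (e i - a i)) ((v - a i) / (e i - a i))) ∧
      ((¬ ∃ i : A, u ∈ Icc (a i) (e i) ∧ v ∈ Icc (a i) (e i)) → T u v = min u v))

/-- Squaring reflects the order. Among continuous t-norms this singles out the power stable ones. -/
def SquareReflectsLE (T : ℝ → ℝ → ℝ) : Prop :=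
  ∀ u ∈ Icc (0:ℝ) 1, ∀ v ∈ Icc (0:ℝ) 1, T u u ≤ T v v → u ≤ v

namespace IsTnorm

variable {T : ℝ → ℝ → ℝ} {u v w x y : ℝ}

local notation "I" => Icc (0:ℝ) 1

lemma zero_mem : (0:ℝ) ∈ I := ⟨le_rfl, zero_le_one⟩

lemma one_mem : (1:ℝ) ∈ I := ⟨zero_le_one, le_rfl⟩

/-! ### Order and integer powers -/

section Basic

variable (hT : IsTnorm T)
include hT

lemma mono_both (hu : u ∈ I) (hv : v ∈ I) (hx : x ∈ I) (hy : y ∈ I) (hux : u ≤ x)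
    (hvy : v ≤ y) : T u v ≤ T x y := by
  calc T u v ≤ T u y := hT.mono u hu v hv y hy hvy
    _ = T y u := hT.comm u hu y hy
    _ ≤ T y x := hT.mono y hy u hu x hx hux
    _ = T x y := hT.comm y hy x hx

lemma one_left (hu : u ∈ I) : T 1 u = u := by
  rw [hT.comm 1 one_mem u hu, hT.one u hu]

lemma le_left (hu : u ∈ I) (hv : v ∈ I) : T u v ≤ u := by
  simpa [hT.one u hu] using hT.mono u hu v hv 1 one_mem hv.2

lemma le_right (hu : u ∈ I) (hv : v ∈ I) : T u v ≤ v := by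
  rw [hT.comm u hu v hv]
  exact hT.le_left hv hu

lemma zero_right (hu : u ∈ I) : T u 0 = 0 :=
  le_antisymm (hT.le_right hu zero_mem) (hT.maps_to u hu 0 zero_mem).1

lemma mul_mul_comm {a b c d : ℝ} (ha : a ∈ I) (hb : b ∈ I) (hc : c ∈ I) (hd : d ∈ I) :
    T (T a b) (T c d) = T (T a c) (T b d) := by
  rw [hT.assoc a ha b hb _ (hT.maps_to c hc d hd), hT.assoc a ha c hc _ (hT.maps_to b hb d hd),
    ← hT.assoc b hb c hc d hd, ← hT.assoc c hc b hb d hd, hT.comm b hb c hc]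

lemma pow_mem (hu : u ∈ I) (n : ℕ) : Tpow T u n ∈ I := by
  induction n with
  | zero => exact one_mem
  | succ n ih => exact hT.maps_to _ ih u hu

lemma pow_one (hu : u ∈ I) : Tpow T u 1 = u := hT.one_left hu

lemma pow_two (hu : u ∈ I) : Tpow T u 2 = T u u := by
  change T (Tpow T u 1) u = _
  rw [hT.pow_one hu]

lemma pow_add (hu : u ∈ I) (m n : ℕ) : Tpow T u (m + n) = T (Tpow T u m) (Tpow T u n) := by
  induction n with
  | zero => exact (hT.one _ (hT.pow_mem hu m)).symm
  | succ n ih =>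
    change T (Tpow T u (m + n)) u = T _ (T (Tpow T u n) u)
    rw [ih, hT.assoc _ (hT.pow_mem hu m) _ (hT.pow_mem hu n) u hu]

lemma pow_mul (hu : u ∈ I) (m n : ℕ) : Tpow T u (m * n) = Tpow T (Tpow T u m) n := by
  induction n with
  | zero => rfl
  | succ n ih =>
    rw [Nat.mul_succ, hT.pow_add hu, ih]
    rfl

lemma mul_pow (hu : u ∈ I) (hv : v ∈ I) (n : ℕ) :
    Tpow T (T u v) n = T (Tpow T u n) (Tpow T v n) := by
  induction n with
  | zero => exact (hT.one 1 one_mem).symm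
  | succ n ih =>
    change T (Tpow T (T u v) n) (T u v) = T (T _ u) (T _ v)
    rw [ih, hT.mul_mul_comm (hT.pow_mem hu n) (hT.pow_mem hv n) hu hv]

lemma pow_mono (hu : u ∈ I) (hv : v ∈ I) (huv : u ≤ v) (n : ℕ) : Tpow T u n ≤ Tpow T v n := by
  induction n with
  | zero => exact le_rfl
  | succ n ih => exact hT.mono_both (hT.pow_mem hu n) hu (hT.pow_mem hv n) hv ih huv

lemma pow_anti (hu : u ∈ I) {m n : ℕ} (hmn : m ≤ n) : Tpow T u n ≤ Tpow T u m := by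
  obtain ⟨k, rfl⟩ := Nat.exists_eq_add_of_le hmn
  rw [hT.pow_add hu]
  exact hT.le_left (hT.pow_mem hu m) (hT.pow_mem hu k)

lemma zero_pow {n : ℕ} (hn : 0 < n) : Tpow T 0 n = 0 := by
  refine le_antisymm ?_ (hT.pow_mem zero_mem n).1
  simpa [hT.pow_one zero_mem] using hT.pow_anti zero_mem hn

lemma one_pow (n : ℕ) : Tpow T 1 n = 1 := by
  induction n with
  | zero => rfl
  | succ n ih =>
    change T (Tpow T 1 n) 1 = 1
    rw [ih, hT.one 1 one_mem]

lemma tendsto_pow_iInf (hu : u ∈ I) :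
    Filter.Tendsto (Tpow T u) Filter.atTop (nhds (⨅ n, Tpow T u n)) :=
  tendsto_atTop_ciInf (antitone_nat_of_succ_le fun n => hT.pow_anti hu n.le_succ)
    ⟨0, by rintro _ ⟨n, rfl⟩; exact (hT.pow_mem hu n).1⟩

lemma iInf_pow_le (hu : u ∈ I) (n : ℕ) : ⨅ n, Tpow T u n ≤ Tpow T u n :=
  ciInf_le ⟨0, by rintro _ ⟨n, rfl⟩; exact (hT.pow_mem hu n).1⟩ n

lemma iInf_pow_mem (hu : u ∈ I) : ⨅ n, Tpow T u n ∈ I :=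
  ⟨le_ciInf fun n => (hT.pow_mem hu n).1, hT.iInf_pow_le hu 0⟩

lemma pow_reflects_le (hS : SquareReflectsLE T) (hu : u ∈ I) (hv : v ∈ I) {n : ℕ} (hn : 0 < n)
    (h : Tpow T u n ≤ Tpow T v n) : u ≤ v := by
  by_contra! hvu
  have hlarge : ∀ m, n ≤ m → Tpow T u m ≤ Tpow T v m := by
    intro m hm
    induction m, hm using Nat.le_induction with
    | base => exact h
    | succ m hm ih =>
      obtain ⟨k, rfl⟩ : ∃ k, m = k + 1 := ⟨m - 1, by omega⟩
      have hPu := hT.pow_mem hu (k + 1)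
      have hPv := hT.pow_mem hv (k + 1)
      have hk := hT.pow_mem hv k
      have hk' := hT.pow_mem hu k
      calc Tpow T u (k + 1 + 1) ≤ T (Tpow T v (k + 1)) u := hT.mono_both hPu hu hPv hu ih le_rfl
        _ = T (T (Tpow T v k) u) v := by
          change T (T _ v) u = _
          rw [hT.assoc _ hk v hv u hu, hT.comm v hv u hu, hT.assoc _ hk u hu v hv]
        _ ≤ T (T (Tpow T u k) u) v :=
          hT.mono_both (hT.maps_to _ hk u hu) hv (hT.maps_to _ hk' u hu) hv
            (hT.mono_both hk hu hk' hu (hT.pow_mono hv hu hvu.le k) le_rfl) le_rfl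
        _ ≤ Tpow T v (k + 1 + 1) := hT.mono_both hPu hv hPv hv ih le_rfl
  have htwo : ∀ k, Tpow T u (2 ^ k) ≤ Tpow T v (2 ^ k) → u ≤ v := by
    intro k
    induction k with
    | zero => simp [hT.pow_one hu, hT.pow_one hv]
    | succ k ih =>
      intro hk
      rw [_root_.pow_succ, hT.pow_mul hu, hT.pow_mul hv, hT.pow_two (hT.pow_mem hu _),
        hT.pow_two (hT.pow_mem hv _)] at hk
      exact ih (hS _ (hT.pow_mem hu _) _ (hT.pow_mem hv _) hk)
  exact absurd (htwo n (hlarge _ n.lt_two_pow_self.le)) (not_le.2 hvu)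

lemma pow_injective (hS : SquareReflectsLE T) (hu : u ∈ I) (hv : v ∈ I) {n : ℕ} (hn : 0 < n)
    (h : Tpow T u n = Tpow T v n) : u = v :=
  le_antisymm (hT.pow_reflects_le hS hu hv hn h.le)
    (hT.pow_reflects_le hS hv hu hn h.ge)

end Basic

/-! ### Roots and rational powers of a continuous t-norm -/

section Continuous

variable (hT : IsTnorm T) (hTc : ContinuousOn2 T)
include hT hTc

omit hT in
lemma continuousOn_right (hu : u ∈ I) : ContinuousOn (T u) I :=
  ContinuousOn.comp (f := fun y => (u, y)) hTc (by fun_prop) fun _ hy => ⟨hu, hy⟩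

lemma continuousOn_pow (n : ℕ) : ContinuousOn (fun u => Tpow T u n) I := by
  induction n with
  | zero => exact continuousOn_const
  | succ n ih =>
    exact ContinuousOn.comp (f := fun u => (Tpow T u n, u)) hTc (ih.prodMk continuousOn_id)
      fun u hu => ⟨hT.pow_mem hu n, hu⟩

/-- The root is the least preimage under the power map. -/
lemma root_spec (hu : u ∈ I) {p : ℕ} (hp : 0 < p) :
    Troot T u p ∈ I ∧ Tpow T (Troot T u p) p = u ∧
      ∀ v ∈ I, u ≤ Tpow T v p → Troot T u p ≤ v := by
  have himage : u ∈ (fun v => Tpow T v p) '' I := by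
    refine intermediate_value_Icc zero_le_one (hT.continuousOn_pow hTc p) ?_
    simpa [hT.zero_pow hp, hT.one_pow] using hu
  have hcompact : IsCompact (I ∩ (fun v => Tpow T v p) ⁻¹' {u}) :=
    isCompact_Icc.of_isClosed_subset
      ((hT.continuousOn_pow hTc p).preimage_isClosed_of_isClosed isClosed_Icc isClosed_singleton)
      inter_subset_left
  obtain ⟨m, ⟨hm, hmu⟩, hleast⟩ := hcompact.exists_isLeast (by
    obtain ⟨v, hv, hvu⟩ := himage
    exact ⟨v, hv, hvu⟩)
  replace hmu : Tpow T m p = u := hmu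
  have hset : {v ∈ I | Tpow T v p < u} = Ico 0 m := by
    ext v
    constructor
    · rintro ⟨hv, hvu⟩
      refine ⟨hv.1, lt_of_not_ge fun h => ?_⟩
      exact absurd (hT.pow_mono hm hv h p) (by rw [hmu]; exact not_le.2 hvu)
    · rintro ⟨hv0, hvm⟩
      have hv : v ∈ I := ⟨hv0, hvm.le.trans hm.2⟩
      refine ⟨hv, lt_of_le_of_ne (hmu ▸ hT.pow_mono hv hm hvm.le p) fun h => ?_⟩
      exact absurd (hleast ⟨hv, h⟩) (not_le.2 hvm)
  have hroot : Troot T u p = m := by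
    unfold Troot
    rw [hset]
    rcases hm.1.eq_or_lt with h | h
    · simp [← h]
    · exact csSup_Ico h
  rw [hroot]
  refine ⟨hm, hmu, fun v hv huv => le_of_not_gt fun h => ?_⟩
  have : Tpow T v p = u := le_antisymm (hmu ▸ hT.pow_mono hv hm h.le p) huv
  exact absurd (hleast ⟨hv, this⟩) (not_le.2 h)

lemma root_mem (hu : u ∈ I) {p : ℕ} (hp : 0 < p) : Troot T u p ∈ I :=
  (hT.root_spec hTc hu hp).1

lemma pow_root (hu : u ∈ I) {p : ℕ} (hp : 0 < p) : Tpow T (Troot T u p) p = u :=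
  (hT.root_spec hTc hu hp).2.1

lemma root_le (hu : u ∈ I) (hv : v ∈ I) {p : ℕ} (hp : 0 < p) (h : u ≤ Tpow T v p) :
    Troot T u p ≤ v :=
  (hT.root_spec hTc hu hp).2.2 v hv h

lemma root_mul_pow (hu : u ∈ I) {d k : ℕ} (hd : 0 < d) (hk : 0 < k) :
    Tpow T (Troot T u (d * k)) k = Troot T u d := by
  have hdk := Nat.mul_pos hd hk
  have hR := hT.root_mem hTc hu hdk
  have hRd := hT.root_mem hTc hu hd
  have hRR := hT.root_mem hTc hRd hk
  apply le_antisymm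
  · calc _ ≤ Tpow T (Troot T (Troot T u d) k) k := by
          refine hT.pow_mono hR hRR (hT.root_le hTc hu hRR hdk ?_) k
          rw [mul_comm d k, hT.pow_mul hRR, hT.pow_root hTc hRd hk, hT.pow_root hTc hu hd]
      _ = _ := hT.pow_root hTc hRd hk
  · refine hT.root_le hTc hu (hT.pow_mem hR k) hd ?_
    rw [← hT.pow_mul hR, mul_comm k d, hT.pow_root hTc hu hdk]

/-- Rational powers do not depend on the representation of the exponent as a fraction. -/
lemma ratPow_eq (hu : u ∈ I) {r : ℚ} (hr : 0 ≤ r) {N m : ℕ} (hN : 0 < N)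
    (h : r * N = m) : TratPow T u r = Tpow T (Troot T u N) m := by
  obtain ⟨n, hn⟩ := Int.eq_ofNat_of_zero_le (Rat.num_nonneg.2 hr)
  have hrd : r * r.den = n := by
    rw [Rat.mul_den_eq_num, hn]
    rfl
  have hd : (r.den : ℚ) ≠ 0 := by exact_mod_cast r.den_nz
  have hcross : n * N = m * r.den := by
    have : (n * N : ℚ) = m * r.den := by rw [← hrd, ← h]; ring
    exact_mod_cast this
  have hcop : r.den.Coprime n := by
    have := r.reduced
    rw [hn] at this
    exact this.symm
  obtain ⟨k, rfl⟩ : r.den ∣ N :=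
    hcop.dvd_of_dvd_mul_left (hcross ▸ Dvd.intro_left m rfl)
  have hk : 0 < k := Nat.pos_of_mul_pos_left hN
  have hm : m = k * n := by
    apply Nat.eq_of_mul_eq_mul_right r.den_pos
    rw [← hcross]
    ring
  unfold TratPow
  rw [hm, hT.pow_mul (hT.root_mem hTc hu hN), hT.root_mul_pow hTc hu r.den_pos hk, hn]
  rfl

omit hT hTc in
lemma exists_common_denominator {r s : ℚ} (hr : 0 ≤ r) (hs : 0 ≤ s) :
    ∃ N m n : ℕ, 0 < N ∧ r * N = m ∧ s * N = n := by
  refine ⟨r.den * s.den, r.num.toNat * s.den, s.num.toNat * r.den,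
    Nat.mul_pos r.den_pos s.den_pos, ?_, ?_⟩
  · have h : ((r.num.toNat : ℕ) : ℚ) = r.num := by
      exact_mod_cast Int.toNat_of_nonneg (Rat.num_nonneg.2 hr)
    push_cast
    rw [h, ← Rat.mul_den_eq_num]
    ring
  · have h : ((s.num.toNat : ℕ) : ℚ) = s.num := by
      exact_mod_cast Int.toNat_of_nonneg (Rat.num_nonneg.2 hs)
    push_cast
    rw [h, ← Rat.mul_den_eq_num]
    ring

lemma ratPow_mem (hu : u ∈ I) (r : ℚ) : TratPow T u r ∈ I :=
  hT.pow_mem (hT.root_mem hTc hu r.den_pos) _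

lemma ratPow_anti (hu : u ∈ I) {r s : ℚ} (hr : 0 ≤ r) (hrs : r ≤ s) :
    TratPow T u s ≤ TratPow T u r := by
  obtain ⟨N, m, n, hN, hm, hn⟩ := exists_common_denominator hr (hr.trans hrs)
  rw [hT.ratPow_eq hTc hu hr hN hm, hT.ratPow_eq hTc hu (hr.trans hrs) hN hn]
  refine hT.pow_anti (hT.root_mem hTc hu hN) ?_
  have : (m : ℚ) ≤ n := by rw [← hm, ← hn]; gcongr
  exact_mod_cast this

lemma ratPow_mono (hu : u ∈ I) (hv : v ∈ I) (huv : u ≤ v) (r : ℚ) :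
    TratPow T u r ≤ TratPow T v r :=
  hT.pow_mono (hT.root_mem hTc hu r.den_pos) (hT.root_mem hTc hv r.den_pos)
    (hT.root_le hTc hu (hT.root_mem hTc hv r.den_pos) r.den_pos
      (by rwa [hT.pow_root hTc hv r.den_pos])) _

lemma pow_ratPow (hu : u ∈ I) {r : ℚ} (hr : 0 ≤ r) {N m : ℕ} (hN : 0 < N)
    (h : r * N = m) : Tpow T (TratPow T u r) N = Tpow T u m := by
  have hR := hT.root_mem hTc hu hN
  rw [hT.ratPow_eq hTc hu hr hN h, ← hT.pow_mul hR, mul_comm, hT.pow_mul hR,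
    hT.pow_root hTc hu hN]

lemma ratPow_one (hu : u ∈ I) : TratPow T u 1 = u := by
  rw [← hT.pow_one (hT.ratPow_mem hTc hu 1),
    hT.pow_ratPow hTc hu zero_le_one (m := 1) Nat.one_pos (by norm_num), hT.pow_one hu]

/-! ### Real powers of a continuous t-norm -/

lemma le_rePow_iff (hu : u ∈ I) {t : ℝ} (ht : 0 ≤ t) :
    x ≤ TrePow T u t ↔ ∀ r : ℚ, 0 ≤ r → (r : ℝ) ≤ t → x ≤ TratPow T u r := by
  unfold TrePow
  rw [le_csInf_iff ⟨0, ?_⟩ ?_]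
  · simp only [mem_image, mem_ofPred_eq, forall_exists_index, and_imp]
    exact ⟨fun h r h0 h1 => h _ r h0 h1 rfl, fun h b r h0 h1 hb => hb ▸ h r h0 h1⟩
  · rintro _ ⟨r, -, rfl⟩
    exact (hT.ratPow_mem hTc hu r).1
  · exact ⟨_, 0, ⟨le_rfl, by simpa using ht⟩, rfl⟩

lemma rePow_le (hu : u ∈ I) {t : ℝ} {r : ℚ} (hr : 0 ≤ r) (hrt : (r : ℝ) ≤ t) :
    TrePow T u t ≤ TratPow T u r :=
  (hT.le_rePow_iff hTc hu ((Rat.cast_nonneg.2 hr).trans hrt)).1 le_rfl r hr hrt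

lemma rePow_mem (hu : u ∈ I) {t : ℝ} (ht : 0 ≤ t) : TrePow T u t ∈ I :=
  ⟨(hT.le_rePow_iff hTc hu ht).2 fun r _ _ => (hT.ratPow_mem hTc hu r).1,
    (hT.rePow_le hTc hu le_rfl (by simpa using ht)).trans (hT.ratPow_mem hTc hu 0).2⟩

lemma rePow_ratCast (hu : u ∈ I) {r : ℚ} (hr : 0 ≤ r) : TrePow T u r = TratPow T u r := by
  refine le_antisymm (hT.rePow_le hTc hu hr le_rfl) ?_
  refine (hT.le_rePow_iff hTc hu (Rat.cast_nonneg.2 hr)).2 fun s hs hsr => ?_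
  exact hT.ratPow_anti hTc hu hs (by exact_mod_cast hsr)

lemma rePow_one (hu : u ∈ I) : TrePow T u 1 = u := by
  simpa [hT.ratPow_one hTc hu] using hT.rePow_ratCast hTc hu (r := 1) zero_le_one

lemma rePow_two (hu : u ∈ I) : TrePow T u 2 = T u u := by
  have h : TratPow T u 2 = T u u := by
    rw [← hT.pow_one (hT.ratPow_mem hTc hu 2),
      hT.pow_ratPow hTc hu (m := 2) (by norm_num) Nat.one_pos (by norm_num), hT.pow_two hu]
  simpa [h] using hT.rePow_ratCast hTc hu (r := 2) (by norm_num)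

lemma rePow_half (hu : u ∈ I) : TrePow T u (1 / 2) = Troot T u 2 := by
  have h : TratPow T u (1 / 2) = Troot T u 2 := by
    rw [hT.ratPow_eq hTc hu (m := 1) (by norm_num) Nat.two_pos (by norm_num),
      hT.pow_one (hT.root_mem hTc hu Nat.two_pos)]
  rw [← h, ← hT.rePow_ratCast hTc hu (by norm_num)]
  norm_num

lemma exists_seq_ratPow (hu : u ∈ I) {t : ℝ} (ht : 0 ≤ t) :
    ∃ r : ℕ → ℚ, (∀ n, 0 ≤ r n ∧ (r n : ℝ) ≤ t) ∧
      Filter.Tendsto (fun n => TratPow T u (r n)) Filter.atTop (nhds (TrePow T u t)) := by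
  obtain ⟨f, -, hf, hmem⟩ := exists_seq_tendsto_sInf
    (S := TratPow T u '' {r : ℚ | 0 ≤ r ∧ (r : ℝ) ≤ t})
    ⟨_, 0, ⟨le_rfl, by simpa using ht⟩, rfl⟩
    ⟨0, by rintro _ ⟨r, -, rfl⟩; exact (hT.ratPow_mem hTc hu r).1⟩
  choose r hr hrf using hmem
  exact ⟨r, hr, by simpa only [hrf, TrePow] using hf⟩

/-! ### Consequences of squaring reflecting the order -/

lemma squareReflectsLE_of_root_mul_self (h : ∀ u ∈ I, Troot T (T u u) 2 = u) :
    SquareReflectsLE T := by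
  intro u hu v hv huv
  rw [← h u hu]
  exact hT.root_le hTc (hT.maps_to u hu u hu) hv Nat.two_pos (by rwa [hT.pow_two hv])

lemma iInf_pow_idempotent (hu : u ∈ I) :
    T (⨅ n, Tpow T u n) (⨅ n, Tpow T u n) = ⨅ n, Tpow T u n := by
  have hL := hT.iInf_pow_mem hu
  have hlim := hT.tendsto_pow_iInf hu
  refine le_antisymm (hT.le_left hL hL) ?_
  have h : Filter.Tendsto (fun n => T (Tpow T u n) (Tpow T u n)) Filter.atTop
      (nhds (T (⨅ n, Tpow T u n) (⨅ n, Tpow T u n))) := by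
    refine Filter.Tendsto.comp (f := fun n => (Tpow T u n, Tpow T u n))
      (hTc (_, _) ⟨hL, hL⟩).tendsto ?_
    exact tendsto_nhdsWithin_iff.2 ⟨hlim.prodMk_nhds hlim, Filter.Eventually.of_forall
      fun n => ⟨hT.pow_mem hu n, hT.pow_mem hu n⟩⟩
  refine ge_of_tendsto' h fun n => ?_
  rw [← hT.pow_add hu]
  exact hT.iInf_pow_le hu (n + n)

/-- An element below an idempotent is absorbed by it. -/
lemma idempotent_mul (hw : w ∈ I) (hww : T w w = w) (hx : x ∈ I) (hxw : x ≤ w) :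
    T w x = x := by
  obtain ⟨y, hy, rfl⟩ : x ∈ T w '' I := by
    refine intermediate_value_Icc zero_le_one (continuousOn_right hTc hw) ?_
    rw [hT.zero_right hw, hT.one w hw]
    exact ⟨hx.1, hxw⟩
  rw [← hT.assoc w hw w hw y hy, hww]

variable (hS : SquareReflectsLE T)
include hS

lemma ratPow_mul (hu : u ∈ I) (hv : v ∈ I) {r : ℚ} (hr : 0 ≤ r) :
    TratPow T (T u v) r = T (TratPow T u r) (TratPow T v r) := by
  obtain ⟨N, m, -, hN, hm, -⟩ := exists_common_denominator hr hr
  have huv := hT.maps_to u hu v hv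
  have hQu := hT.ratPow_mem hTc hu r
  have hQv := hT.ratPow_mem hTc hv r
  apply hT.pow_injective hS (hT.ratPow_mem hTc huv r) (hT.maps_to _ hQu _ hQv) hN
  rw [hT.pow_ratPow hTc huv hr hN hm, hT.mul_pow hu hv, hT.mul_pow hQu hQv,
    hT.pow_ratPow hTc hu hr hN hm, hT.pow_ratPow hTc hv hr hN hm]

lemma ratPow_add (hu : u ∈ I) {r s : ℚ} (hr : 0 ≤ r) (hs : 0 ≤ s) :
    TratPow T u (r + s) = T (TratPow T u r) (TratPow T u s) := by
  obtain ⟨N, m, n, hN, hm, hn⟩ := exists_common_denominator hr hs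
  have hQr := hT.ratPow_mem hTc hu r
  have hQs := hT.ratPow_mem hTc hu s
  apply hT.pow_injective hS (hT.ratPow_mem hTc hu _) (hT.maps_to _ hQr _ hQs) hN
  rw [hT.pow_ratPow hTc hu (add_nonneg hr hs) hN (m := m + n) (by push_cast; rw [← hm, ← hn]; ring),
    hT.mul_pow hQr hQs, hT.pow_ratPow hTc hu hr hN hm, hT.pow_ratPow hTc hu hs hN hn,
    hT.pow_add hu]

lemma ratPow_ratPow (hu : u ∈ I) {r s : ℚ} (hr : 0 ≤ r) (hs : 0 ≤ s) :
    TratPow T (TratPow T u r) s = TratPow T u (r * s) := by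
  obtain ⟨N, m, n, hN, hm, hn⟩ := exists_common_denominator hr hs
  have hQr := hT.ratPow_mem hTc hu r
  have hQQ := hT.ratPow_mem hTc hQr s
  apply hT.pow_injective hS hQQ (hT.ratPow_mem hTc hu _) (Nat.mul_pos hN hN)
  rw [hT.pow_ratPow hTc hu (mul_nonneg hr hs) (Nat.mul_pos hN hN) (m := m * n)
    (by push_cast; rw [← hm, ← hn]; ring), hT.pow_mul hQQ, hT.pow_ratPow hTc hQr hs hN hn,
    ← hT.pow_mul hQr, mul_comm, hT.pow_mul hQr, hT.pow_ratPow hTc hu hr hN hm, hT.pow_mul hu]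

lemma le_ratPow_iff (hu : u ∈ I) (hx : x ∈ I) {s : ℚ} (hs : 0 < s) :
    x ≤ TratPow T u s ↔ TratPow T x s⁻¹ ≤ u := by
  have hs' : 0 ≤ s⁻¹ := inv_nonneg.2 hs.le
  constructor
  · intro h
    have := hT.ratPow_mono hTc hx (hT.ratPow_mem hTc hu s) h s⁻¹
    rwa [hT.ratPow_ratPow hTc hS hu hs.le hs', mul_inv_cancel₀ hs.ne', hT.ratPow_one hTc hu]
      at this
  · intro h
    have := hT.ratPow_mono hTc (hT.ratPow_mem hTc hx s⁻¹) hu h s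
    rwa [hT.ratPow_ratPow hTc hS hx hs' hs.le, inv_mul_cancel₀ hs.ne', hT.ratPow_one hTc hx]
      at this

lemma le_of_forall_le_ratPow (hw : w ∈ I) (hx : x ∈ I)
    (h : ∀ r : ℚ, 0 ≤ r → r < 1 → x ≤ TratPow T w r) : x ≤ w := by
  set y : ℕ → ℝ := fun k => TratPow T w ((1 / 2) ^ (k + 1)) with hy
  have hymem : ∀ k, y k ∈ I := fun k => hT.ratPow_mem hTc hw _
  have hpos : ∀ k : ℕ, (0:ℚ) ≤ (1 / 2) ^ k := fun k => by positivity
  have hymono : Monotone y := monotone_nat_of_le_succ fun k => by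
    refine hT.ratPow_anti hTc hw (hpos _) ?_
    exact pow_le_pow_of_le_one (by norm_num) (by norm_num) (Nat.le_succ _)
  have hbdd : BddAbove (range y) := ⟨1, by rintro _ ⟨k, rfl⟩; exact (hymem k).2⟩
  set z := ⨆ k, y k with hz
  have hyz : ∀ k, y k ≤ z := le_ciSup hbdd
  have hzmem : z ∈ I := ⟨(hymem 0).1.trans (hyz 0), ciSup_le fun k => (hymem k).2⟩
  have hzz : T z z = z := by
    refine le_antisymm (hT.le_left hzmem hzmem) (ciSup_le fun k => ?_)
    calc y k = T (y (k + 1)) (y (k + 1)) := by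
          rw [hy, ← hT.ratPow_add hTc hS hw (hpos _) (hpos _)]
          ring_nf
      _ ≤ T z z := hT.mono_both (hymem _) (hymem _) hzmem hzmem (hyz _) (hyz _)
  have hxz : x ≤ z := (h ((1 / 2) ^ (0 + 1)) (hpos _) (by norm_num)).trans (hyz 0)
  have hlim : Filter.Tendsto (fun k => T x (y k)) Filter.atTop (nhds (T x z)) := by
    refine (continuousOn_right hTc hx z hzmem).tendsto.comp ?_
    exact tendsto_nhdsWithin_iff.2
      ⟨tendsto_atTop_ciSup hymono hbdd, Filter.Eventually.of_forall hymem⟩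
  calc x = T x z := by rw [hT.comm x hx z hzmem, hT.idempotent_mul hTc hzmem hzz hx hxz]
    _ ≤ w := by
      refine le_of_tendsto' hlim fun k => ?_
      have hlt : ((1:ℚ) / 2) ^ (k + 1) ≤ 1 := pow_le_one₀ (by norm_num) (by norm_num)
      have hk : (0:ℚ) < (1 / 2) ^ (k + 1) := by positivity
      have hr : (0:ℚ) ≤ 1 - (1 / 2) ^ (k + 1) := sub_nonneg.2 hlt
      calc T x (y k) ≤ T (TratPow T w (1 - (1 / 2) ^ (k + 1))) (y k) :=
            hT.mono_both hx (hymem k) (hT.ratPow_mem hTc hw _) (hymem k)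
              (h _ hr (by linarith)) le_rfl
        _ = w := by
          rw [hy, ← hT.ratPow_add hTc hS hw hr (hpos _), sub_add_cancel, hT.ratPow_one hTc hw]

/-- Rational powers are left continuous in the exponent. -/
lemma le_ratPow_of_forall_lt (hu : u ∈ I) (hx : x ∈ I) {q : ℚ} (hq : 0 < q)
    (h : ∀ r : ℚ, 0 ≤ r → r < q → x ≤ TratPow T u r) : x ≤ TratPow T u q := by
  refine hT.le_of_forall_le_ratPow hTc hS (hT.ratPow_mem hTc hu q) hx fun r hr hr1 => ?_
  rw [hT.ratPow_ratPow hTc hS hu hq.le hr]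
  exact h _ (mul_nonneg hq.le hr) (mul_lt_of_lt_one_right hq hr1)

lemma rePow_mul (hu : u ∈ I) (hv : v ∈ I) {t : ℝ} (ht : 0 ≤ t) :
    TrePow T (T u v) t = T (TrePow T u t) (TrePow T v t) := by
  have huv := hT.maps_to u hu v hv
  have hXu := hT.rePow_mem hTc hu ht
  have hXv := hT.rePow_mem hTc hv ht
  apply le_antisymm
  · obtain ⟨r, hr, hrlim⟩ := hT.exists_seq_ratPow hTc hu ht
    obtain ⟨s, hs, hslim⟩ := hT.exists_seq_ratPow hTc hv ht
    have hlim : Filter.Tendsto (fun n => T (TratPow T u (r n)) (TratPow T v (s n)))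
        Filter.atTop (nhds (T (TrePow T u t) (TrePow T v t))) := by
      refine Filter.Tendsto.comp (f := fun n => (TratPow T u (r n), TratPow T v (s n)))
        (hTc (TrePow T u t, TrePow T v t) ⟨hXu, hXv⟩).tendsto ?_
      exact tendsto_nhdsWithin_iff.2 ⟨hrlim.prodMk_nhds hslim, Filter.Eventually.of_forall
        fun n => ⟨hT.ratPow_mem hTc hu _, hT.ratPow_mem hTc hv _⟩⟩
    refine ge_of_tendsto' hlim fun n => ?_
    have hmax : 0 ≤ max (r n) (s n) := (hr n).1.trans (le_max_left _ _)
    calc TrePow T (T u v) t ≤ TratPow T (T u v) (max (r n) (s n)) := by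
          refine hT.rePow_le hTc huv hmax ?_
          rw [Rat.cast_max]
          exact max_le (hr n).2 (hs n).2
      _ = T (TratPow T u (max (r n) (s n))) (TratPow T v (max (r n) (s n))) :=
          hT.ratPow_mul hTc hS hu hv hmax
      _ ≤ _ := hT.mono_both (hT.ratPow_mem hTc hu _) (hT.ratPow_mem hTc hv _)
          (hT.ratPow_mem hTc hu _) (hT.ratPow_mem hTc hv _)
          (hT.ratPow_anti hTc hu (hr n).1 (le_max_left _ _))
          (hT.ratPow_anti hTc hv (hs n).1 (le_max_right _ _))
  · refine (hT.le_rePow_iff hTc huv ht).2 fun r hr hrt => ?_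
    rw [hT.ratPow_mul hTc hS hu hv hr]
    exact hT.mono_both hXu hXv (hT.ratPow_mem hTc hu _) (hT.ratPow_mem hTc hv _)
      (hT.rePow_le hTc hu hr hrt) (hT.rePow_le hTc hv hr hrt)

lemma le_rePow_rePow_iff (hu : u ∈ I) (hx : x ∈ I) {t₁ t₂ : ℝ} (h₁ : 0 ≤ t₁) (h₂ : 0 ≤ t₂) :
    x ≤ TrePow T (TrePow T u t₁) t₂ ↔
      ∀ r s : ℚ, 0 ≤ r → (r : ℝ) ≤ t₁ → 0 < s → (s : ℝ) ≤ t₂ → x ≤ TratPow T u (r * s) := by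
  have hX := hT.rePow_mem hTc hu h₁
  have key : ∀ s : ℚ, 0 < s → (x ≤ TratPow T (TrePow T u t₁) s ↔
      ∀ r : ℚ, 0 ≤ r → (r : ℝ) ≤ t₁ → x ≤ TratPow T u (r * s)) := by
    intro s hs
    rw [hT.le_ratPow_iff hTc hS hX hx hs, hT.le_rePow_iff hTc hu h₁]
    refine forall₃_congr fun r hr hrt => ?_
    rw [← hT.le_ratPow_iff hTc hS (hT.ratPow_mem hTc hu r) hx hs,
      hT.ratPow_ratPow hTc hS hu hr hs.le]
  rw [hT.le_rePow_iff hTc hX h₂]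
  constructor
  · intro h r s hr hr₁ hs hs₂
    exact (key s hs).1 (h s hs.le hs₂) r hr hr₁
  · intro h s hs hs₂
    rcases hs.eq_or_lt with rfl | hs
    · exact hx.2
    · exact (key s hs).2 fun r hr hr₁ => h r s hr hr₁ hs hs₂

lemma rePow_rePow (hu : u ∈ I) {t₁ t₂ : ℝ} (h₁ : 0 < t₁) (h₂ : 0 < t₂) :
    TrePow T (TrePow T u t₁) t₂ = TrePow T u (t₁ * t₂) := by
  have h₁₂ := mul_pos h₁ h₂
  have hX := hT.rePow_mem hTc (hT.rePow_mem hTc hu h₁.le) h₂.le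
  apply le_antisymm
  · have h := (hT.le_rePow_rePow_iff hTc hS hu hX h₁.le h₂.le).1 le_rfl
    have hlt : ∀ q : ℚ, 0 ≤ q → (q : ℝ) < t₁ * t₂ →
        TrePow T (TrePow T u t₁) t₂ ≤ TratPow T u q := by
      intro q hq hqt
      obtain ⟨s, hqs, hs₂⟩ := exists_rat_btwn ((div_lt_iff₀' h₁).2 hqt)
      have hs : (0:ℝ) < s := (div_nonneg (Rat.cast_nonneg.2 hq) h₁.le).trans_lt hqs
      have hs' : 0 < s := by exact_mod_cast hs
      have := h (q / s) s (div_nonneg hq hs'.le) (by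
        push_cast
        rw [div_le_iff₀ hs]
        exact ((div_lt_iff₀' h₁).1 hqs).le) hs' hs₂.le
      rwa [div_mul_cancel₀ _ hs'.ne'] at this
    refine (hT.le_rePow_iff hTc hu h₁₂.le).2 fun q hq hqt => ?_
    rcases hqt.eq_or_lt with heq | hqt
    · have hq' : 0 < q := by
        rw [← heq] at h₁₂
        exact_mod_cast h₁₂
      refine hT.le_ratPow_of_forall_lt hTc hS hu hX hq' fun r hr hrq => hlt r hr ?_
      rw [← heq]
      exact_mod_cast hrq
    · exact hlt q hq hqt
  · refine (hT.le_rePow_rePow_iff hTc hS hu (hT.rePow_mem hTc hu h₁₂.le) h₁.le h₂.le).2 ?_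
    intro r s hr hr₁ hs hs₂
    refine hT.rePow_le hTc hu (mul_nonneg hr hs.le) ?_
    push_cast
    gcongr

/-! ### The ordinal sum decomposition -/

/-- On an interval between consecutive idempotents, `T` is strictly monotone. -/
lemma lt_of_between_idempotents {a e z : ℝ} (ha : a ∈ I) (haa : T a a = a) (he : e ∈ I)
    (hee : T e e = e) (hgap : ∀ w ∈ Ioo a e, T w w ≠ w) (hx : x ∈ Ioc a e) (hy : y ∈ Icc a e)
    (hz : z ∈ Icc a e) (hyz : y < z) : T x y < T x z := by
  have hx' : x ∈ I := ⟨ha.1.trans hx.1.le, hx.2.trans he.2⟩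
  have hy' : y ∈ I := ⟨ha.1.trans hy.1, hy.2.trans he.2⟩
  have hz' : z ∈ I := ⟨ha.1.trans hz.1, hz.2.trans he.2⟩
  refine lt_of_le_of_ne (hT.mono x hx' y hy' z hz' hyz.le) fun heq => ?_
  obtain ⟨s, hs, rfl⟩ : y ∈ T z '' I := by
    refine intermediate_value_Icc zero_le_one (continuousOn_right hTc hz') ?_
    rw [hT.zero_right hz', hT.one z hz']
    exact ⟨hy'.1, hyz.le⟩
  have hse : s < e := by
    by_contra! h
    have hze : T z e = z := by
      rw [hT.comm z hz' e he, hT.idempotent_mul hTc he hee hz' hz.2]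
    exact absurd (hT.mono z hz' e he s hs h) (by rw [hze]; exact not_le.2 hyz)
  have has : a ≤ s := hy.1.trans (hT.le_right hz' hs)
  have hxz := hT.maps_to x hx' z hz'
  have hfix : T (T x z) s = T x z := by rw [hT.assoc x hx' z hz' s hs, heq]
  have hpow : ∀ n, T (T x z) (Tpow T s n) = T x z := by
    intro n
    induction n with
    | zero => exact hT.one _ hxz
    | succ n ih =>
      change T _ (T (Tpow T s n) s) = _
      rw [← hT.assoc _ hxz _ (hT.pow_mem hs n) s hs, ih, hfix]
  have hapow : ∀ n, a ≤ Tpow T s n := by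
    intro n
    induction n with
    | zero => exact ha.2
    | succ n ih => exact haa ▸ hT.mono_both ha ha (hT.pow_mem hs n) hs ih has
  have hLmem := hT.iInf_pow_mem hs
  have hL : ⨅ n, Tpow T s n = a := by
    by_contra hne
    refine hgap _ ⟨lt_of_le_of_ne (le_ciInf hapow) (Ne.symm hne), ?_⟩
      (hT.iInf_pow_idempotent hTc hs)
    exact (hT.iInf_pow_le hs 1).trans_lt ((hT.pow_one hs).trans_lt hse)
  have hxza : T x z ≤ a := by
    have hlim : Filter.Tendsto (fun n => T (T x z) (Tpow T s n)) Filter.atTop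
        (nhds (T (T x z) (⨅ n, Tpow T s n))) :=
      (continuousOn_right hTc hxz _ hLmem).tendsto.comp (tendsto_nhdsWithin_iff.2
        ⟨hT.tendsto_pow_iInf hs, Filter.Eventually.of_forall fun n => hT.pow_mem hs n⟩)
    simp only [hpow, hL] at hlim
    rw [tendsto_nhds_unique tendsto_const_nhds hlim]
    exact hT.le_right hxz ha
  have hm : min x z ∈ I := ⟨le_min hx'.1 hz'.1, (min_le_left _ _).trans hx'.2⟩
  have hma : min x z ≤ a := hS _ hm a ha <| by
    rw [haa]
    exact (hT.mono_both hm hm hx' hz' (min_le_left _ _) (min_le_right _ _)).trans hxza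
  exact absurd hma (not_le.2 (lt_min hx.1 (hy.1.trans_lt hyz)))

lemma isStrictTnorm_rescale {a e : ℝ} (ha : a ∈ I) (haa : T a a = a) (he : e ∈ I)
    (hee : T e e = e) (hae : a < e) (hgap : ∀ w ∈ Ioo a e, T w w ≠ w) :
    IsStrictTnorm fun x y => (T (a + (e - a) * x) (a + (e - a) * y) - a) / (e - a) := by
  have hd : 0 < e - a := sub_pos.2 hae
  have hscale : ∀ x ∈ I, a + (e - a) * x ∈ Icc a e := fun x hx =>
    ⟨by nlinarith [hx.1], by nlinarith [hx.2]⟩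
  have hI : ∀ x ∈ Icc a e, x ∈ I := fun x hx => ⟨ha.1.trans hx.1, hx.2.trans he.2⟩
  have hmem : ∀ x ∈ I, a + (e - a) * x ∈ I := fun x hx => hI _ (hscale x hx)
  have hback : ∀ t : ℝ, a + (e - a) * ((t - a) / (e - a)) = t := fun t => by
    field_simp
    ring
  have hclosed : ∀ x ∈ Icc a e, ∀ y ∈ Icc a e, T x y ∈ Icc a e := fun x hx y hy =>
    ⟨haa ▸ hT.mono_both ha ha (hI x hx) (hI y hy) hx.1 hy.1,
      (hT.le_left (hI x hx) (hI y hy)).trans hx.2⟩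
  refine ⟨⟨?_, ?_, ?_, ?_, ?_⟩, ?_, ?_⟩
  · intro x hx y hy
    have h := hclosed _ (hscale x hx) _ (hscale y hy)
    refine ⟨div_nonneg (sub_nonneg.2 h.1) hd.le, (div_le_one hd).2 ?_⟩
    linarith [h.2]
  · intro x hx y hy
    simp only [hT.comm _ (hmem x hx) _ (hmem y hy)]
  · intro x hx y hy z hz
    simp only [hback]
    rw [hT.assoc _ (hmem x hx) _ (hmem y hy) _ (hmem z hz)]
  · intro x hx y hy z hz hyz
    have := hT.mono _ (hmem x hx) _ (hmem y hy) _ (hmem z hz) (by gcongr)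
    gcongr
  · intro x hx
    have : T (a + (e - a) * x) e = a + (e - a) * x := by
      rw [hT.comm _ (hmem x hx) e he, hT.idempotent_mul hTc he hee (hmem x hx) (hscale x hx).2]
    simp only [mul_one, add_sub_cancel, this]
    field_simp
    ring
  · have h : ContinuousOn (fun p : ℝ × ℝ => T (a + (e - a) * p.1) (a + (e - a) * p.2)) (I ×ˢ I) :=
      ContinuousOn.comp (f := fun p : ℝ × ℝ => (a + (e - a) * p.1, a + (e - a) * p.2)) hTc
        (by fun_prop) fun p hp => ⟨hmem _ hp.1, hmem _ hp.2⟩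
    exact (h.sub continuousOn_const).div_const _
  · intro x hx hx0 y hy z hz hyz
    have := hT.lt_of_between_idempotents hTc hS ha haa he hee hgap
      (x := a + (e - a) * x) ⟨by nlinarith, (hscale x hx).2⟩ (hscale y hy) (hscale z hz)
      (by gcongr)
    simp only
    gcongr

omit hS in
/-- `T` agrees with the minimum at two points that are not enclosed by a pair of consecutive
idempotents. -/
lemma eq_left_of_not_enclosed (hu : u ∈ I) (hv : v ∈ I) (huv : u ≤ v)
    (h : ∀ a ∈ I, ∀ e ∈ I, T a a = a → T e e = e → a < e → (∀ w ∈ Ioo a e, T w w ≠ w) →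
      u ∈ Icc a e → v ∈ Icc a e → False) : T u v = u := by
  by_cases hw : ∃ w ∈ Icc u v, T w w = w
  · obtain ⟨w, hw, hww⟩ := hw
    have hwI : w ∈ I := ⟨hu.1.trans hw.1, hw.2.trans hv.2⟩
    refine le_antisymm (hT.le_left hu hv) ?_
    calc u = T u w := by rw [hT.comm u hu w hwI, hT.idempotent_mul hTc hwI hww hu hw.1]
      _ ≤ T u v := hT.mono u hu w hwI v hv hw.2
  · push Not at hw
    have hdiag : ContinuousOn (fun w => T w w) I :=
      ContinuousOn.comp (f := fun w : ℝ => (w, w)) hTc (by fun_prop) fun w hw => ⟨hw, hw⟩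
    have hcompact : ∀ c d : ℝ, 0 ≤ c → d ≤ 1 → IsCompact {w ∈ Icc c d | T w w = w} := by
      intro c d hc hd
      have hcont : ContinuousOn (fun w => T w w - w) (Icc c d) :=
        (hdiag.mono (Icc_subset_Icc hc hd)).sub continuousOn_id
      have := hcont.preimage_isClosed_of_isClosed isClosed_Icc (isClosed_singleton (x := 0))
      refine isCompact_Icc.of_isClosed_subset (s := Icc c d) ?_ fun w hw => hw.1
      convert this using 1
      ext w
      simp [sub_eq_zero]
    obtain ⟨a, ⟨ha, haa⟩, hamax⟩ := (hcompact 0 u le_rfl hu.2).exists_isGreatest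
      ⟨0, ⟨le_rfl, hu.1⟩, hT.zero_right zero_mem⟩
    obtain ⟨e, ⟨he, hee⟩, hemin⟩ := (hcompact v 1 hv.1 le_rfl).exists_isLeast
      ⟨1, ⟨hv.2, le_rfl⟩, hT.one 1 one_mem⟩
    have hau : a < u := lt_of_le_of_ne ha.2 fun h => hw a ⟨h.ge, ha.2.trans huv⟩ haa
    refine (h a ⟨ha.1, ha.2.trans hu.2⟩ e ⟨hv.1.trans he.1, he.2⟩ haa hee
      (hau.trans_le (huv.trans he.1)) ?_ ⟨ha.2, huv.trans he.1⟩ ⟨ha.2.trans huv, he.1⟩).elim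
    intro w hwae hww
    rcases le_or_gt w u with hwu | huw
    · exact absurd (hamax ⟨⟨ha.1.trans hwae.1.le, hwu⟩, hww⟩) (not_le.2 hwae.1)
    rcases le_or_gt v w with hvw | hwv
    · exact absurd (hemin ⟨⟨hvw, hwae.2.le.trans he.2⟩, hww⟩) (not_le.2 hwae.2)
    · exact hw w ⟨huw.le, hwv.le⟩ hww

lemma isOrdinalSumOfStrict : IsOrdinalSumOfStrict T := by
  let A := {p : ℝ × ℝ // p.1 ∈ I ∧ p.2 ∈ I ∧ T p.1 p.1 = p.1 ∧ T p.2 p.2 = p.2 ∧ p.1 < p.2 ∧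
    ∀ w ∈ Ioo p.1 p.2, T w w ≠ w}
  have hdisj : Pairwise fun i j : A => Disjoint (Ioo i.1.1 i.1.2) (Ioo j.1.1 j.1.2) := by
    rintro ⟨⟨a, e⟩, ha, he, haa, hee, hae, hgap⟩ ⟨⟨b, f⟩, hb, hf, hbb, hff, hbf, hgap'⟩ hne
    rw [Set.disjoint_left]
    intro w hw hw'
    dsimp only at *
    apply hne
    have hab : a = b := by
      rcases lt_trichotomy a b with h | h | h
      · exact (hgap b ⟨h, hw'.1.trans hw.2⟩ hbb).elim
      · exact h
      · exact (hgap' a ⟨h, hw.1.trans hw'.2⟩ haa).elim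
    have hef : e = f := by
      rcases lt_trichotomy e f with h | h | h
      · exact (hgap' e ⟨hw'.1.trans hw.2, h⟩ hee).elim
      · exact h
      · exact (hgap f ⟨hw.1.trans hw'.2, h⟩ hff).elim
    subst hab hef
    rfl
  have hcount : Countable A :=
    Pairwise.countable_of_isOpen_disjoint hdisj (fun _ => isOpen_Ioo)
      fun i => nonempty_Ioo.2 i.2.2.2.2.2.1
  refine ⟨A, hcount, fun i => i.1.1, fun i => i.1.2,
    fun i x y => (T (i.1.1 + (i.1.2 - i.1.1) * x) (i.1.1 + (i.1.2 - i.1.1) * y) - i.1.1) /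
      (i.1.2 - i.1.1), fun i => ⟨i.2.1.1, i.2.2.2.2.2.1, i.2.2.1.2⟩, hdisj, ?_, ?_⟩
  · rintro ⟨⟨a, e⟩, ha, he, haa, hee, hae, hgap⟩
    exact hT.isStrictTnorm_rescale hTc hS ha haa he hee hae hgap
  · intro u hu v hv
    constructor
    · rintro ⟨⟨a, e⟩, -, -, -, -, hae, -⟩ - -
      dsimp only at *
      have hd : e - a ≠ 0 := (sub_pos.2 hae).ne'
      simp only [mul_div_cancel₀ _ hd, add_sub_cancel]
    · intro h
      have key : ∀ a ∈ I, ∀ e ∈ I, T a a = a → T e e = e → a < e →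
          (∀ w ∈ Ioo a e, T w w ≠ w) → u ∈ Icc a e → v ∈ Icc a e → False :=
        fun a ha e he haa hee hae hgap hua hva =>
          h ⟨⟨(a, e), ha, he, haa, hee, hae, hgap⟩, hua, hva⟩
      rcases le_total u v with huv | hvu
      · rw [min_eq_left huv, hT.eq_left_of_not_enclosed hTc hu hv huv key]
      · rw [min_eq_right hvu, hT.comm u hu v hv, hT.eq_left_of_not_enclosed hTc hv hu hvu
          fun a ha e he haa hee hae hgap hva hua => key a ha e he haa hee hae hgap hua hva]

end Continuous

lemma square_lt_of_strictMono (hT : IsTnorm T) (hs : TnormStrictMono T) (hu : u ∈ I)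
    (hv : v ∈ I) (hvu : v < u) : T v v < T u u := by
  have hu0 : 0 < u := hv.1.trans_lt hvu
  calc T v v ≤ T u v := hT.mono_both hv hv hu hv hvu.le le_rfl
    _ < T u u := hs u hu hu0 v hv u hu hvu

lemma squareReflectsLE_of_isOrdinalSum (hT : IsTnorm T) (h : IsOrdinalSumOfStrict T) :
    SquareReflectsLE T := by
  obtain ⟨A, -, a, e, Tf, hae, -, hstrict, hsum⟩ := h
  have hscale : ∀ i, ∀ w ∈ Icc (a i) (e i), (w - a i) / (e i - a i) ∈ I := fun i w hw =>
    have hd := sub_pos.2 (hae i).2.1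
    ⟨div_nonneg (sub_nonneg.2 hw.1) hd.le, (div_le_one hd).2 (by linarith [hw.2])⟩
  intro u hu v hv huv
  by_contra! hvu
  by_cases hi : ∃ i, u ∈ Icc (a i) (e i) ∧ v ∈ Icc (a i) (e i)
  · obtain ⟨i, hui, hvi⟩ := hi
    have hd := sub_pos.2 (hae i).2.1
    have hlt := square_lt_of_strictMono (hstrict i).1 (hstrict i).2.2 (hscale i u hui)
      (hscale i v hvi) (by gcongr)
    rw [(hsum u hu u hu).1 i hui hui, (hsum v hv v hv).1 i hvi hvi] at huv
    nlinarith
  · have huv' : T u v = v := by rw [(hsum u hu v hv).2 hi, min_eq_right hvu.le]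
    have huu : T u u = v := le_antisymm (huv.trans (hT.le_left hv hv))
      (huv' ▸ hT.mono u hu v hv u hu hvu.le)
    by_cases hj : ∃ i, u ∈ Icc (a i) (e i) ∧ u ∈ Icc (a i) (e i)
    · obtain ⟨i, hui, -⟩ := hj
      have hd := sub_pos.2 (hae i).2.1
      have hm := (hstrict i).1.maps_to _ (hscale i u hui) _ (hscale i u hui)
      refine hi ⟨i, hui, ?_, hvu.le.trans hui.2⟩
      rw [← huu, (hsum u hu u hu).1 i hui hui]
      nlinarith [hm.1]
    · rw [(hsum u hu u hu).2 hj, min_self] at huu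
      exact hvu.ne huu.symm

end IsTnorm

/-- For a continuous t-norm `T`, the following are equivalent:
(i) `T` is power stable; (ii) every point of `[0,1]` is power stable;
(iii) `T` is the minimum t-norm, or strict, or an ordinal sum of strict t-norms. -/
theorem power_stability_characterization (T : ℝ → ℝ → ℝ) (hT : IsTnorm T)
    (hTc : ContinuousOn2 T) :
    ((∀ u ∈ Icc (0:ℝ) 1, ∀ v ∈ Icc (0:ℝ) 1, ∀ t : ℝ, 0 < t →
        TrePow T (T u v) t = T (TrePow T u t) (TrePow T v t)) ↔
      (∀ u ∈ Icc (0:ℝ) 1, ∀ t₁ t₂ : ℝ, 0 < t₁ → 0 < t₂ →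
        TrePow T (TrePow T u t₁) t₂ = TrePow T u (t₁ * t₂))) ∧
    ((∀ u ∈ Icc (0:ℝ) 1, ∀ v ∈ Icc (0:ℝ) 1, ∀ t : ℝ, 0 < t →
        TrePow T (T u v) t = T (TrePow T u t) (TrePow T v t)) ↔
      ((∀ u ∈ Icc (0:ℝ) 1, ∀ v ∈ Icc (0:ℝ) 1, T u v = min u v) ∨
        TnormStrictMono T ∨ IsOrdinalSumOfStrict T)) := by
  have hmem : ∀ u ∈ Icc (0:ℝ) 1, T u u ∈ Icc (0:ℝ) 1 := fun u hu => hT.maps_to u hu u hu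
  have hstable : (∀ u ∈ Icc (0:ℝ) 1, ∀ v ∈ Icc (0:ℝ) 1, ∀ t : ℝ, 0 < t →
      TrePow T (T u v) t = T (TrePow T u t) (TrePow T v t)) ↔ SquareReflectsLE T := by
    refine ⟨fun h => hT.squareReflectsLE_of_root_mul_self hTc fun u hu => ?_,
      fun hS u hu v hv t ht => hT.rePow_mul hTc hS hu hv ht.le⟩
    rw [← hT.rePow_half hTc (hmem u hu), h u hu u hu _ one_half_pos, hT.rePow_half hTc hu,
      ← hT.pow_two (hT.root_mem hTc hu Nat.two_pos), hT.pow_root hTc hu Nat.two_pos]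
  have hpoints : (∀ u ∈ Icc (0:ℝ) 1, ∀ t₁ t₂ : ℝ, 0 < t₁ → 0 < t₂ →
      TrePow T (TrePow T u t₁) t₂ = TrePow T u (t₁ * t₂)) ↔ SquareReflectsLE T := by
    refine ⟨fun h => hT.squareReflectsLE_of_root_mul_self hTc fun u hu => ?_,
      fun hS u hu t₁ t₂ h₁ h₂ => hT.rePow_rePow hTc hS hu h₁ h₂⟩
    rw [← hT.rePow_half hTc (hmem u hu), ← hT.rePow_two hTc hu,
      h u hu 2 (1 / 2) two_pos one_half_pos, mul_one_div_cancel two_ne_zero, hT.rePow_one hTc hu]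
  have hsum : ((∀ u ∈ Icc (0:ℝ) 1, ∀ v ∈ Icc (0:ℝ) 1, T u v = min u v) ∨
      TnormStrictMono T ∨ IsOrdinalSumOfStrict T) ↔ SquareReflectsLE T := by
    refine ⟨?_, fun hS => Or.inr (Or.inr (hT.isOrdinalSumOfStrict hTc hS))⟩
    rintro (h | h | h)
    · intro u hu v hv huv
      rwa [h u hu u hu, h v hv v hv, min_self, min_self] at huv
    · intro u hu v hv huv
      by_contra! hvu
      exact absurd huv (not_le.2 (hT.square_lt_of_strictMono h hu hv hvu))
    · exact hT.squareReflectsLE_of_isOrdinalSum h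
  exact ⟨hstable.trans hpoints.symm, hstable.trans hsum.symm⟩
end

section
/- Let T be a continuous t-norm on [0,1] with dual t-conorm S. Then for all intuitionistic fuzzy values α = ⟨μ_α, ν_α⟩ and β = ⟨μ_β, ν_β⟩ and every real λ > 0, each of α ⊕_T β = ⟨S(μ_α, μ_β), T(ν_α, ν_β)⟩, α ⊗_T β = ⟨T(μ_α, μ_β), S(ν_α, ν_β)⟩, λ_T α = ⟨(μ_α)_S^(λ), (ν_α)_T^(λ)⟩, and α^(λ_T) = ⟨(μ_α)_T^(λ), (ν_α)_S^(λ)⟩ is again an intuitionistic fuzzy value, i.e., its two components lie in [0,1] and sum to at most 1. -/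
open Set

theorem IsTnorm.mono_both_s18 {T : ℝ → ℝ → ℝ} (hT : IsTnorm T) {a b c d : ℝ}
    (ha : a ∈ Icc (0:ℝ) 1) (hb : b ∈ Icc (0:ℝ) 1) (hc : c ∈ Icc (0:ℝ) 1) (hd : d ∈ Icc (0:ℝ) 1)
    (hac : a ≤ c) (hbd : b ≤ d) : T a b ≤ T c d :=
  calc T a b ≤ T a d := hT.mono a ha b hb d hd hbd
    _ = T d a := hT.comm a ha d hd
    _ ≤ T d c := hT.mono d hd a ha c hc hac
    _ = T c d := hT.comm d hd c hc

theorem IsTnorm.pow_mem_s18 {T : ℝ → ℝ → ℝ} (hT : IsTnorm T) {u : ℝ} (hu : u ∈ Icc (0:ℝ) 1) (n : ℕ) :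
    Tpow T u n ∈ Icc (0:ℝ) 1 := by
  induction n with
  | zero => simp [Tpow]
  | succ n ih => exact hT.maps_to _ ih _ hu

theorem IsTnorm.pow_mono_s18 {T : ℝ → ℝ → ℝ} (hT : IsTnorm T) {u v : ℝ} (hu : u ∈ Icc (0:ℝ) 1)
    (hv : v ∈ Icc (0:ℝ) 1) (huv : u ≤ v) (n : ℕ) : Tpow T u n ≤ Tpow T v n := by
  induction n with
  | zero => exact le_rfl
  | succ n ih => exact hT.mono_both_s18 (hT.pow_mem_s18 hu n) hu (hT.pow_mem_s18 hv n) hv ih huv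

theorem Spow_eq_one_sub_Tpow {T S : ℝ → ℝ → ℝ} (hdual : ∀ x y : ℝ, S x y = 1 - T (1 - x) (1 - y))
    (u : ℝ) (n : ℕ) : Spow S u n = 1 - Tpow T (1 - u) n := by
  induction n with
  | zero => simp [Spow, Tpow]
  | succ n ih => simp [Spow, Tpow, hdual, ih]

theorem one_sub_mem_Icc {x : ℝ} (hx : x ∈ Icc (0:ℝ) 1) : 1 - x ∈ Icc (0:ℝ) 1 :=
  ⟨sub_nonneg.2 hx.2, sub_le_self _ hx.1⟩

theorem sSup_mem_unit {A : Set ℝ} (hA : A ⊆ Icc (0:ℝ) 1) : sSup A ∈ Icc (0:ℝ) 1 :=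
  ⟨Real.sSup_nonneg fun _ hx => (hA hx).1, Real.sSup_le (fun _ hx => (hA hx).2) zero_le_one⟩

theorem sInf_mem_unit {A : Set ℝ} (hA : A ⊆ Icc (0:ℝ) 1) : sInf A ∈ Icc (0:ℝ) 1 := by
  refine ⟨Real.sInf_nonneg fun _ hx => (hA hx).1, ?_⟩
  rcases A.eq_empty_or_nonempty with rfl | ⟨x, hx⟩
  · simp
  · exact (csInf_le ⟨0, fun _ hy => (hA hy).1⟩ hx).trans (hA hx).2

theorem Troot_mem (T : ℝ → ℝ → ℝ) (u : ℝ) (p : ℕ) : Troot T u p ∈ Icc (0:ℝ) 1 :=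
  sSup_mem_unit fun _ hx => hx.1

theorem Sroot_mem (S : ℝ → ℝ → ℝ) (u : ℝ) (p : ℕ) : Sroot S u p ∈ Icc (0:ℝ) 1 :=
  sInf_mem_unit fun _ hx => hx.1

theorem Troot_le_one_sub_Sroot {T S : ℝ → ℝ → ℝ}
    (hdual : ∀ x y : ℝ, S x y = 1 - T (1 - x) (1 - y)) {μ ν : ℝ} (h : μ + ν ≤ 1) (p : ℕ) :
    Troot T ν p ≤ 1 - Sroot S μ p := by
  refine Real.sSup_le (fun b hb => ?_) (sub_nonneg.2 (Sroot_mem S μ p).2)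
  have hmem : 1 - b ∈ {v ∈ Icc (0:ℝ) 1 | μ < Spow S v p} := by
    refine ⟨one_sub_mem_Icc hb.1, ?_⟩
    rw [Spow_eq_one_sub_Tpow hdual, sub_sub_cancel]
    linarith [hb.2]
  have := csInf_le ⟨0, fun _ hy => hy.1.1⟩ hmem
  unfold Sroot
  linarith

theorem SrePow_add_TrePow_le_one {T S : ℝ → ℝ → ℝ} (hT : IsTnorm T)
    (hdual : ∀ x y : ℝ, S x y = 1 - T (1 - x) (1 - y)) {μ ν : ℝ} (h : μ + ν ≤ 1) (t : ℝ) :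
    SrePow S μ t ∈ Icc (0:ℝ) 1 ∧ TrePow T ν t ∈ Icc (0:ℝ) 1 ∧
      SrePow S μ t + TrePow T ν t ≤ 1 := by
  have hTr (r : ℚ) : TratPow T ν r ∈ Icc (0:ℝ) 1 := hT.pow_mem_s18 (Troot_mem T ν _) _
  have hSr (r : ℚ) : SratPow S μ r ∈ Icc (0:ℝ) 1 := by
    rw [SratPow, Spow_eq_one_sub_Tpow hdual]
    exact one_sub_mem_Icc (hT.pow_mem_s18 (one_sub_mem_Icc (Sroot_mem S μ _)) _)
  have hTm : TrePow T ν t ∈ Icc (0:ℝ) 1 := by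
    refine sInf_mem_unit ?_
    rintro _ ⟨r, -, rfl⟩
    exact hTr r
  refine ⟨?_, hTm, ?_⟩
  · refine sSup_mem_unit ?_
    rintro _ ⟨r, -, rfl⟩
    exact hSr r
  · suffices SrePow S μ t ≤ 1 - TrePow T ν t by linarith
    refine Real.sSup_le ?_ (sub_nonneg.2 hTm.2)
    rintro _ ⟨r, hr, rfl⟩
    have h₁ : TrePow T ν t ≤ TratPow T ν r := by
      refine csInf_le ⟨0, ?_⟩ (mem_image_of_mem _ hr)
      rintro _ ⟨s, -, rfl⟩
      exact (hTr s).1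
    have h₂ : TratPow T ν r ≤ Tpow T (1 - Sroot S μ r.den) r.num.toNat :=
      hT.pow_mono_s18 (Troot_mem T ν _) (one_sub_mem_Icc (Sroot_mem S μ _))
        (Troot_le_one_sub_Sroot hdual h _) _
    rw [SratPow, Spow_eq_one_sub_Tpow hdual]
    linarith

theorem S_add_T_le_one {T S : ℝ → ℝ → ℝ} (hT : IsTnorm T)
    (hdual : ∀ x y : ℝ, S x y = 1 - T (1 - x) (1 - y)) {μ ν μ' ν' : ℝ}
    (hμ : μ ∈ Icc (0:ℝ) 1) (hν : ν ∈ Icc (0:ℝ) 1) (hμ' : μ' ∈ Icc (0:ℝ) 1)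
    (hν' : ν' ∈ Icc (0:ℝ) 1) (h : μ + ν ≤ 1) (h' : μ' + ν' ≤ 1) :
    S μ μ' ∈ Icc (0:ℝ) 1 ∧ T ν ν' ∈ Icc (0:ℝ) 1 ∧ S μ μ' + T ν ν' ≤ 1 := by
  have hμc := one_sub_mem_Icc hμ
  have hμc' := one_sub_mem_Icc hμ'
  rw [hdual]
  refine ⟨one_sub_mem_Icc (hT.maps_to _ hμc _ hμc'), hT.maps_to _ hν _ hν', ?_⟩
  linarith [hT.mono_both_s18 hν hν' hμc hμc' (by linarith) (by linarith)]

/-- For a continuous t-norm `T` with dual t-conorm `S`, the four basic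
operations `⊕_T`, `⊗_T`, `λ_T α`, `α^(λ_T)` map intuitionistic fuzzy values to
intuitionistic fuzzy values. -/
theorem ifv_operations_closed (T S : ℝ → ℝ → ℝ) (hT : IsTnorm T) (hTc : ContinuousOn2 T)
    (hdual : ∀ x y : ℝ, S x y = 1 - T (1 - x) (1 - y))
    (μa νa μb νb : ℝ)
    (ha : μa ∈ Icc (0:ℝ) 1 ∧ νa ∈ Icc (0:ℝ) 1 ∧ μa + νa ≤ 1)
    (hb : μb ∈ Icc (0:ℝ) 1 ∧ νb ∈ Icc (0:ℝ) 1 ∧ μb + νb ≤ 1)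
    (lam : ℝ) (hlam : 0 < lam) :
    (S μa μb ∈ Icc (0:ℝ) 1 ∧ T νa νb ∈ Icc (0:ℝ) 1 ∧ S μa μb + T νa νb ≤ 1) ∧
    (T μa μb ∈ Icc (0:ℝ) 1 ∧ S νa νb ∈ Icc (0:ℝ) 1 ∧ T μa μb + S νa νb ≤ 1) ∧
    (SrePow S μa lam ∈ Icc (0:ℝ) 1 ∧ TrePow T νa lam ∈ Icc (0:ℝ) 1 ∧
      SrePow S μa lam + TrePow T νa lam ≤ 1) ∧
    (TrePow T μa lam ∈ Icc (0:ℝ) 1 ∧ SrePow S νa lam ∈ Icc (0:ℝ) 1 ∧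
      TrePow T μa lam + SrePow S νa lam ≤ 1) := by
  obtain ⟨hμa, hνa, ha⟩ := ha
  obtain ⟨hμb, hνb, hb⟩ := hb
  have ha' : νa + μa ≤ 1 := by linarith
  have hb' : νb + μb ≤ 1 := by linarith
  refine ⟨S_add_T_le_one hT hdual hμa hνa hμb hνb ha hb, ?_,
    SrePow_add_TrePow_le_one hT hdual ha lam, ?_⟩
  · obtain ⟨hS, hT', hle⟩ := S_add_T_le_one hT hdual hνa hμa hνb hμb ha' hb'
    exact ⟨hT', hS, by linarith⟩
  · obtain ⟨hS, hT', hle⟩ := SrePow_add_TrePow_le_one hT hdual ha' lam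
    exact ⟨hT', hS, by linarith⟩
end
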